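/- (Corollary 1, L₂-stability) Suppose the nonzero constants k_e, k_a, k_u all have the same sign. Consider a trajectory of the mechanical system with inner-loop control u(t) := τ(t) − ∇V_a(q_a(t)) interconnected with the PID through the disturbance d : [0, ∞) → ℝᵐ (continuous), i.e. there is a C¹ curve z₁ : [0, ∞) → ℝᵐ with ż₁(t) = y_d(t) and k_e u(t) = d(t) − ( K_P y_d(t) + K_I z₁(t) + K_D ẏ_d(t) ) for all t ≥ 0. Then the map d ↦ y_d is L₂-stable with gain 1/λ_min(K_P): there exists β₃ ≥ 0 (depending on the initial condition) such that for all t ≥ 0, ( ∫₀ᵗ |y_d(s)|² ds )^{1/2} ≤ (1/λ_min(K_P)) ( ∫₀ᵗ |d(s)|² ds )^{1/2} + β₃. -/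

import Mathlib

open Matrix Set Filter

noncomputable section

/-- Componentwise gradient of a scalar function on `Fin k → ℝ`. -/
def grad {k : ℕ} (f : (Fin k → ℝ) → ℝ) (x : Fin k → ℝ) : Fin k → ℝ :=
  fun i => fderiv ℝ f x (Pi.single i 1)

/-- The block inertia matrix `M(q_u) = [[m_uu, m_auᵀ], [m_au, m_aa]]`. -/
def Mblk {s m : ℕ} (muu : (Fin s → ℝ) → Matrix (Fin s) (Fin s) ℝ)
    (mau : (Fin s → ℝ) → Matrix (Fin m) (Fin s) ℝ)
    (maa : Matrix (Fin m) (Fin m) ℝ) (qu : Fin s → ℝ) :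
    Matrix (Fin s ⊕ Fin m) (Fin s ⊕ Fin m) ℝ :=
  Matrix.fromBlocks (muu qu) (mau qu)ᵀ (mau qu) maa

/-- The Jacobian `J(q, v)` (w.r.t. `q`) of the map `q ↦ M(q_u) v`. -/
def Jmat {s m : ℕ} (muu : (Fin s → ℝ) → Matrix (Fin s) (Fin s) ℝ)
    (mau : (Fin s → ℝ) → Matrix (Fin m) (Fin s) ℝ)
    (maa : Matrix (Fin m) (Fin m) ℝ)
    (q v : (Fin s ⊕ Fin m) → ℝ) :
    Matrix (Fin s ⊕ Fin m) (Fin s ⊕ Fin m) ℝ :=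
  fun i j =>
    fderiv ℝ (fun p : (Fin s ⊕ Fin m) → ℝ =>
      (Mblk muu mau maa (p ∘ Sum.inl) *ᵥ v) i) q (Pi.single j 1)

/-- The Coriolis force vector `C(q, q̇) q̇ = [J(q,q̇) − ½ J(q,q̇)ᵀ] q̇`. -/
def Cvec {s m : ℕ} (muu : (Fin s → ℝ) → Matrix (Fin s) (Fin s) ℝ)
    (mau : (Fin s → ℝ) → Matrix (Fin m) (Fin s) ℝ)
    (maa : Matrix (Fin m) (Fin m) ℝ)
    (q v : (Fin s ⊕ Fin m) → ℝ) : (Fin s ⊕ Fin m) → ℝ :=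
  (Jmat muu mau maa q v - (1/2 : ℝ) • (Jmat muu mau maa q v)ᵀ) *ᵥ v

/-- The Schur complement `m_uu^s(q_u) = m_uu − m_auᵀ m_aa⁻¹ m_au`. -/
def muuS {s m : ℕ} (muu : (Fin s → ℝ) → Matrix (Fin s) (Fin s) ℝ)
    (mau : (Fin s → ℝ) → Matrix (Fin m) (Fin s) ℝ)
    (maa : Matrix (Fin m) (Fin m) ℝ) (qu : Fin s → ℝ) : Matrix (Fin s) (Fin s) ℝ :=
  muu qu - (mau qu)ᵀ * maa⁻¹ * mau qu

/-- `M_a(q_u) = [[m_auᵀ m_aa⁻¹ m_au, m_auᵀ], [m_au, m_aa]]`. -/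
def MaMat {s m : ℕ} (mau : (Fin s → ℝ) → Matrix (Fin m) (Fin s) ℝ)
    (maa : Matrix (Fin m) (Fin m) ℝ) (qu : Fin s → ℝ) :
    Matrix (Fin s ⊕ Fin m) (Fin s ⊕ Fin m) ℝ :=
  Matrix.fromBlocks ((mau qu)ᵀ * maa⁻¹ * mau qu) (mau qu)ᵀ (mau qu) maa

/-- Storage function `H_u(q_u, q̇_u) = ½ q̇_uᵀ m_uu^s(q_u) q̇_u + V_u(q_u)`. -/
def Hu {s m : ℕ} (muu : (Fin s → ℝ) → Matrix (Fin s) (Fin s) ℝ)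
    (mau : (Fin s → ℝ) → Matrix (Fin m) (Fin s) ℝ)
    (maa : Matrix (Fin m) (Fin m) ℝ) (Vu : (Fin s → ℝ) → ℝ)
    (qu vu : Fin s → ℝ) : ℝ :=
  (1/2 : ℝ) * (vu ⬝ᵥ muuS muu mau maa qu *ᵥ vu) + Vu qu

/-- Storage function `H_a(q_u, q̇) = ½ q̇ᵀ M_a(q_u) q̇`. -/
def Ha {s m : ℕ} (mau : (Fin s → ℝ) → Matrix (Fin m) (Fin s) ℝ)
    (maa : Matrix (Fin m) (Fin m) ℝ) (qu : Fin s → ℝ)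
    (qdot : (Fin s ⊕ Fin m) → ℝ) : ℝ :=
  (1/2 : ℝ) * (qdot ⬝ᵥ MaMat mau maa qu *ᵥ qdot)

/-- Passive output `y_u = −m_aa⁻¹ m_au(q_u) q̇_u`. -/
def yU {s m : ℕ} (mau : (Fin s → ℝ) → Matrix (Fin m) (Fin s) ℝ)
    (maa : Matrix (Fin m) (Fin m) ℝ) (qu vu : Fin s → ℝ) : Fin m → ℝ :=
  -(maa⁻¹ *ᵥ (mau qu *ᵥ vu))

/-- Passive output `y_a = m_aa⁻¹ m_au(q_u) q̇_u + q̇_a`. -/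
def yA {s m : ℕ} (mau : (Fin s → ℝ) → Matrix (Fin m) (Fin s) ℝ)
    (maa : Matrix (Fin m) (Fin m) ℝ) (qu vu : Fin s → ℝ) (va : Fin m → ℝ) : Fin m → ℝ :=
  maa⁻¹ *ᵥ (mau qu *ᵥ vu) + va

/-- The signal `y_d = k_a y_a + k_u y_u` along a trajectory. -/
def ydSig {s m : ℕ} (mau : (Fin s → ℝ) → Matrix (Fin m) (Fin s) ℝ)
    (maa : Matrix (Fin m) (Fin m) ℝ) (ka ku : ℝ)
    (q qd : ℝ → (Fin s ⊕ Fin m) → ℝ) (t : ℝ) : Fin m → ℝ :=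
  ka • yA mau maa (q t ∘ Sum.inl) (qd t ∘ Sum.inl) (qd t ∘ Sum.inr)
    + ku • yU mau maa (q t ∘ Sum.inl) (qd t ∘ Sum.inl)

theorem Matrix.IsHermitian.dotProduct_mulVec_comm {ι : Type*} [Fintype ι] {A : Matrix ι ι ℝ}
    (hA : A.IsHermitian) (v w : ι → ℝ) : v ⬝ᵥ A *ᵥ w = w ⬝ᵥ A *ᵥ v := by
  have hT : Aᵀ = A := by rw [← conjTranspose_eq_transpose_of_trivial]; exact hA
  conv_lhs => rw [← hT, dotProduct_transpose_mulVec]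

section Calculus

variable {ι κ : Type*} [Fintype ι] [Fintype κ] {S : Set ℝ} {t : ℝ}

theorem hasDerivWithinAt_dotProduct {f g : ℝ → ι → ℝ} {f' g' : ι → ℝ}
    (hf : HasDerivWithinAt f f' S t) (hg : HasDerivWithinAt g g' S t) :
    HasDerivWithinAt (fun x => f x ⬝ᵥ g x) (f' ⬝ᵥ g t + f t ⬝ᵥ g') S t := by
  rw [hasDerivWithinAt_pi] at hf hg
  have h := HasDerivWithinAt.fun_sum (u := Finset.univ) fun i _ => (hf i).mul (hg i)
  rw [Finset.sum_add_distrib] at h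
  exact h

theorem hasDerivWithinAt_const_mulVec (A : Matrix κ ι ℝ) {f : ℝ → ι → ℝ} {f' : ι → ℝ}
    (hf : HasDerivWithinAt f f' S t) :
    HasDerivWithinAt (fun x => A *ᵥ f x) (A *ᵥ f') S t :=
  (LinearMap.toContinuousLinearMap (Matrix.mulVecLin A)).hasFDerivAt.comp_hasDerivWithinAt t hf

theorem hasDerivWithinAt_half_quadratic {A : Matrix ι ι ℝ} (hA : A.IsHermitian)
    {f : ℝ → ι → ℝ} {f' : ι → ℝ} (hf : HasDerivWithinAt f f' S t) :
    HasDerivWithinAt (fun x => (1 / 2 : ℝ) * (f x ⬝ᵥ A *ᵥ f x)) (f t ⬝ᵥ A *ᵥ f') S t := by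
  have h := (hasDerivWithinAt_dotProduct hf (hasDerivWithinAt_const_mulVec A hf)).const_mul
    (1 / 2 : ℝ)
  refine h.congr_deriv ?_
  rw [hA.dotProduct_mulVec_comm f']
  ring

theorem ContinuousLinearMap.apply_eq_sum_single [DecidableEq ι] (L : (ι → ℝ) →L[ℝ] ℝ) (v : ι → ℝ) :
    L v = ∑ i, L (Pi.single i 1) * v i := by
  conv_lhs => rw [pi_eq_sum_univ' v]
  simp [map_sum, mul_comm]

end Calculus

section Matrices

variable {ι : Type*} [Fintype ι] [DecidableEq ι]

theorem Matrix.IsHermitian.iInf_eigenvalues_mul_le {A : Matrix ι ι ℝ} (hA : A.IsHermitian)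
    (y : ι → ℝ) : (⨅ i, hA.eigenvalues i) * (y ⬝ᵥ y) ≤ y ⬝ᵥ A *ᵥ y := by
  set l := ⨅ i, hA.eigenvalues i
  have hD : (diagonal fun i => hA.eigenvalues i - l).PosSemidef :=
    PosSemidef.diagonal fun i => sub_nonneg.2 (ciInf_le (finite_range _).bddBelow i)
  have hU := hD.mul_mul_conjTranspose_same (hA.eigenvectorUnitary : Matrix ι ι ℝ)
  have key : (hA.eigenvectorUnitary : Matrix ι ι ℝ) * (diagonal fun i => hA.eigenvalues i - l) *
      (hA.eigenvectorUnitary : Matrix ι ι ℝ)ᴴ = A - l • (1 : Matrix ι ι ℝ) := by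
    have h1 : (diagonal fun i => hA.eigenvalues i - l)
        = diagonal (RCLike.ofReal ∘ hA.eigenvalues) - l • (1 : Matrix ι ι ℝ) := by
      ext i j
      by_cases h : i = j <;> simp [diagonal, h]
    have h2 := hA.spectral_theorem
    rw [Unitary.conjStarAlgAut_apply] at h2
    rw [h1, mul_sub, sub_mul]
    conv_rhs => rw [h2]
    congr 1
    rw [← Matrix.star_eq_conjTranspose, mul_smul_comm, mul_one, smul_mul_assoc,
      Unitary.mul_star_self_of_mem hA.eigenvectorUnitary.2]
  rw [key] at hU
  have := hU.dotProduct_mulVec_nonneg y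
  simp only [star_trivial, sub_mulVec, smul_mulVec, one_mulVec, dotProduct_sub, dotProduct_smul,
    smul_eq_mul] at this
  linarith

theorem Matrix.PosDef.iInf_eigenvalues_pos [Nonempty ι] {A : Matrix ι ι ℝ} (hA : A.PosDef) :
    0 < ⨅ i, hA.1.eigenvalues i := by
  obtain ⟨i, hi⟩ := exists_eq_ciInf_of_finite (f := hA.1.eigenvalues)
  rw [← hi]
  exact hA.eigenvalues_pos i

end Matrices

theorem dotProduct_le_add_weighted {ι : Type*} [Fintype ι] {l : ℝ} (hl : 0 < l) (y d : ι → ℝ) :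
    y ⬝ᵥ d ≤ l / 2 * (y ⬝ᵥ y) + 1 / (2 * l) * (d ⬝ᵥ d) := by
  simp only [dotProduct, Finset.mul_sum, ← Finset.sum_add_distrib]
  refine Finset.sum_le_sum fun i _ => ?_
  have h : l / 2 * (y i * y i) + 1 / (2 * l) * (d i * d i) - y i * d i
      = (l * y i - d i) ^ 2 / (2 * l) := by
    field_simp; ring
  have : 0 ≤ (l * y i - d i) ^ 2 / (2 * l) := by positivity
  linarith

/-- A nonnegative storage function dissipating `l |y|²` against the supply rate `y ⬝ᵥ d` gives an
`L₂` gain of at most `1 / l`. -/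
theorem exists_L2_gain_of_storage {ι : Type*} [Fintype ι] {l : ℝ} (hl : 0 < l) {y d : ℝ → ι → ℝ}
    (hy : ContinuousOn y (Ici 0)) (hd : ContinuousOn d (Ici 0)) {S S' : ℝ → ℝ}
    (hS : ∀ t ∈ Ici (0 : ℝ), HasDerivWithinAt S (S' t) (Ici 0) t) (hS0 : ∀ t ∈ Ici (0 : ℝ), 0 ≤ S t)
    (hdiss : ∀ t ∈ Ici (0 : ℝ), S' t ≤ y t ⬝ᵥ d t - l * (y t ⬝ᵥ y t)) :
    ∃ β : ℝ, 0 ≤ β ∧ ∀ t ∈ Ici (0 : ℝ),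
      Real.sqrt (∫ σ in (0 : ℝ)..t, y σ ⬝ᵥ y σ)
        ≤ (1 / l) * Real.sqrt (∫ σ in (0 : ℝ)..t, d σ ⬝ᵥ d σ) + β := by
  refine ⟨Real.sqrt (2 * S 0 / l), Real.sqrt_nonneg _, fun t ht => ?_⟩
  have ht0 : (0 : ℝ) ≤ t := ht
  have hsub : Icc 0 t ⊆ Ici (0 : ℝ) := Icc_subset_Ici_self
  have cdot : ∀ f : ℝ → ι → ℝ, ContinuousOn f (Ici 0) →
      ContinuousOn (fun σ => f σ ⬝ᵥ f σ) (Icc 0 t) := fun f hf =>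
    continuousOn_finsetSum _ fun i _ =>
      (((continuous_apply i).comp_continuousOn hf).mul
        ((continuous_apply i).comp_continuousOn hf)).mono hsub
  have cy := cdot y hy
  have cd := cdot d hd
  have iy : IntervalIntegrable (fun σ => y σ ⬝ᵥ y σ) MeasureTheory.volume 0 t :=
    cy.intervalIntegrable_of_Icc ht0
  have idd : IntervalIntegrable (fun σ => d σ ⬝ᵥ d σ) MeasureTheory.volume 0 t :=
    cd.intervalIntegrable_of_Icc ht0
  have key := intervalIntegral.sub_le_integral_of_hasDeriv_right_of_le (g := S) (g' := S')
    (φ := fun σ => 1 / (2 * l) * (d σ ⬝ᵥ d σ) - l / 2 * (y σ ⬝ᵥ y σ)) ht0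
    (fun x hx => ((hS x (hsub hx)).continuousWithinAt).mono hsub)
    (fun x hx => (hS x hx.1.le).mono (Ioi_subset_Ici_self.trans (Ici_subset_Ici.2 hx.1.le)))
    (((cd.const_mul _).sub (cy.const_mul _)).integrableOn_Icc)
    (fun x hx => by
      have h1 := hdiss x hx.1.le
      have h2 := dotProduct_le_add_weighted hl (y x) (d x)
      linarith)
  rw [intervalIntegral.integral_sub (idd.const_mul _) (iy.const_mul _),
    intervalIntegral.integral_const_mul, intervalIntegral.integral_const_mul] at key
  have hSt := hS0 t ht
  have hD : 0 ≤ ∫ σ in (0 : ℝ)..t, d σ ⬝ᵥ d σ :=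
    intervalIntegral.integral_nonneg ht0 fun u _ => Finset.sum_nonneg fun i _ => mul_self_nonneg _
  set Y := ∫ σ in (0 : ℝ)..t, y σ ⬝ᵥ y σ
  set D := ∫ σ in (0 : ℝ)..t, d σ ⬝ᵥ d σ
  have hY : Y ≤ D / l ^ 2 + 2 * S 0 / l := by
    have h : l / 2 * Y ≤ 1 / (2 * l) * D + S 0 := by linarith
    have h2 : 2 / l * (l / 2 * Y) ≤ 2 / l * (1 / (2 * l) * D + S 0) :=
      mul_le_mul_of_nonneg_left h (by positivity)
    have h3 : 2 / l * (l / 2 * Y) = Y := by field_simp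
    have h4 : 2 / l * (1 / (2 * l) * D + S 0) = D / l ^ 2 + 2 * S 0 / l := by field_simp
    linarith
  have hb : 0 ≤ 2 * S 0 / l := by have := hS0 0 self_mem_Ici; positivity
  have hsq : Real.sqrt (D / l ^ 2) = 1 / l * Real.sqrt D := by
    rw [Real.sqrt_div hD, Real.sqrt_sq hl.le]; ring
  calc Real.sqrt Y ≤ Real.sqrt (D / l ^ 2 + 2 * S 0 / l) := Real.sqrt_le_sqrt hY
    _ ≤ Real.sqrt (D / l ^ 2) + Real.sqrt (2 * S 0 / l) := by
      refine Real.sqrt_le_iff.2 ⟨by positivity, ?_⟩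
      have h1 := Real.sq_sqrt (div_nonneg hD (sq_nonneg l))
      have h2 := Real.sq_sqrt hb
      have h3 := mul_nonneg (Real.sqrt_nonneg (D / l ^ 2)) (Real.sqrt_nonneg (2 * S 0 / l))
      nlinarith
    _ = _ := by rw [hsq]

section Mechanics

variable {s m : ℕ} {muu : (Fin s → ℝ) → Matrix (Fin s) (Fin s) ℝ}
  {mau : (Fin s → ℝ) → Matrix (Fin m) (Fin s) ℝ} {maa : Matrix (Fin m) (Fin m) ℝ}

theorem differentiable_Mblk_apply
    (hmuu : ∀ i j, ContDiff ℝ (⊤ : ℕ∞) fun x => muu x i j)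
    (hmau : ∀ i j, ContDiff ℝ (⊤ : ℕ∞) fun x => mau x i j) (i j : Fin s ⊕ Fin m) :
    Differentiable ℝ fun p : (Fin s ⊕ Fin m) → ℝ => Mblk muu mau maa (p ∘ Sum.inl) i j := by
  have hproj : Differentiable ℝ fun p : (Fin s ⊕ Fin m) → ℝ => p ∘ (Sum.inl : Fin s → _) :=
    differentiable_pi.2 fun i => differentiable_apply _
  rcases i with i | i <;> rcases j with j | j
  · exact ((hmuu i j).differentiable (by simp)).comp hproj
  · exact ((hmau j i).differentiable (by simp)).comp hproj
  · exact ((hmau i j).differentiable (by simp)).comp hproj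
  · exact differentiable_const _

theorem Jmat_mulVec_apply
    (hmuu : ∀ i j, ContDiff ℝ (⊤ : ℕ∞) fun x => muu x i j)
    (hmau : ∀ i j, ContDiff ℝ (⊤ : ℕ∞) fun x => mau x i j)
    (q v w : (Fin s ⊕ Fin m) → ℝ) (i : Fin s ⊕ Fin m) :
    (Jmat muu mau maa q v *ᵥ w) i
      = ∑ j, fderiv ℝ (fun p : (Fin s ⊕ Fin m) → ℝ => Mblk muu mau maa (p ∘ Sum.inl) i j) q w
          * v j := by
  have h : HasFDerivAt (fun p : (Fin s ⊕ Fin m) → ℝ => (Mblk muu mau maa (p ∘ Sum.inl) *ᵥ v) i)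
      (∑ j, v j • fderiv ℝ (fun p : (Fin s ⊕ Fin m) → ℝ => Mblk muu mau maa (p ∘ Sum.inl) i j) q)
      q :=
    HasFDerivAt.fun_sum (u := Finset.univ) fun j _ =>
      (differentiable_Mblk_apply (maa := maa) hmuu hmau i j q).hasFDerivAt.mul_const (v j)
  have h2 := ContinuousLinearMap.apply_eq_sum_single
    (fderiv ℝ (fun p : (Fin s ⊕ Fin m) → ℝ => (Mblk muu mau maa (p ∘ Sum.inl) *ᵥ v) i) q) w
  calc (Jmat muu mau maa q v *ᵥ w) i = _ := h2.symm
    _ = _ := by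
      rw [h.fderiv]
      simp [mul_comm]

/-- The inertia matrix does not depend on the actuated coordinates. -/
theorem Jmat_apply_inr (q v : (Fin s ⊕ Fin m) → ℝ) (i : Fin s ⊕ Fin m) (j : Fin m) :
    Jmat muu mau maa q v i (Sum.inr j) = 0 := by
  unfold Jmat
  set f := fun p : (Fin s ⊕ Fin m) → ℝ => (Mblk muu mau maa (p ∘ Sum.inl) *ᵥ v) i
  by_cases hf : DifferentiableAt ℝ f q
  · rw [← hf.lineDeriv_eq_fderiv]
    have : (fun t : ℝ => f (q + t • Pi.single (Sum.inr j) (1 : ℝ))) = fun _ => f q := by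
      funext t
      have : (q + t • Pi.single (Sum.inr j) (1 : ℝ)) ∘ Sum.inl = q ∘ (Sum.inl : Fin s → _) := by
        funext k; simp
      simp only [f, this]
    rw [lineDeriv, this, deriv_const]
  · simp [fderiv_zero_of_not_differentiableAt hf]

theorem hasDerivWithinAt_momentum
    (hmuu : ∀ i j, ContDiff ℝ (⊤ : ℕ∞) fun x => muu x i j)
    (hmau : ∀ i j, ContDiff ℝ (⊤ : ℕ∞) fun x => mau x i j)
    {q qd : ℝ → (Fin s ⊕ Fin m) → ℝ} {a : (Fin s ⊕ Fin m) → ℝ} {S : Set ℝ} {t : ℝ}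
    (hq : HasDerivWithinAt q (qd t) S t) (hqd : HasDerivWithinAt qd a S t) :
    HasDerivWithinAt (fun t => Mblk muu mau maa (q t ∘ Sum.inl) *ᵥ qd t)
      (Jmat muu mau maa (q t) (qd t) *ᵥ qd t + Mblk muu mau maa (q t ∘ Sum.inl) *ᵥ a) S t := by
  rw [hasDerivWithinAt_pi] at hqd ⊢
  intro i
  have h := HasDerivWithinAt.fun_sum (u := Finset.univ) fun j _ =>
    ((differentiable_Mblk_apply (maa := maa) hmuu hmau i j (q t)).hasFDerivAt.comp_hasDerivWithinAt
      t hq).mul (hqd j)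
  rw [Finset.sum_add_distrib, ← Jmat_mulVec_apply hmuu hmau] at h
  exact h

theorem dotProduct_Cvec (q v : (Fin s ⊕ Fin m) → ℝ) :
    v ⬝ᵥ Cvec muu mau maa q v = (1 / 2 : ℝ) * (v ⬝ᵥ Jmat muu mau maa q v *ᵥ v) := by
  have : v ⬝ᵥ (Jmat muu mau maa q v)ᵀ *ᵥ v = v ⬝ᵥ Jmat muu mau maa q v *ᵥ v := by
    rw [dotProduct_transpose_mulVec]
  rw [Cvec, sub_mulVec, smul_mulVec, dotProduct_sub, dotProduct_smul, this, smul_eq_mul]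
  ring

theorem Cvec_apply_inr (q v : (Fin s ⊕ Fin m) → ℝ) (i : Fin m) :
    Cvec muu mau maa q v (Sum.inr i) = (Jmat muu mau maa q v *ᵥ v) (Sum.inr i) := by
  have : ((Jmat muu mau maa q v)ᵀ *ᵥ v) (Sum.inr i) = 0 := by
    simp [mulVec, dotProduct, Jmat_apply_inr]
  rw [Cvec, sub_mulVec, smul_mulVec, Pi.sub_apply, Pi.smul_apply, this]
  simp

theorem dotProduct_sum_elim (v : (Fin s ⊕ Fin m) → ℝ) (a : Fin s → ℝ) (b : Fin m → ℝ) :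
    v ⬝ᵥ Sum.elim a b = (v ∘ Sum.inl) ⬝ᵥ a + (v ∘ Sum.inr) ⬝ᵥ b := by
  simp [dotProduct]

theorem posDef_maa {qu : Fin s → ℝ} (hM : (Mblk muu mau maa qu).PosDef) : maa.PosDef :=
  hM.submatrix (e := Sum.inr) Sum.inr_injective

theorem Mblk_mulVec_comp_inr (qu : Fin s → ℝ) (v : (Fin s ⊕ Fin m) → ℝ) :
    (Mblk muu mau maa qu *ᵥ v) ∘ Sum.inr
      = mau qu *ᵥ (v ∘ Sum.inl) + maa *ᵥ (v ∘ Sum.inr) := by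
  funext i
  simp [Mblk, fromBlocks_mulVec]

theorem yA_eq_inv_mulVec_momentum {qu : Fin s → ℝ} (hM : (Mblk muu mau maa qu).PosDef)
    (v : (Fin s ⊕ Fin m) → ℝ) :
    yA mau maa qu (v ∘ Sum.inl) (v ∘ Sum.inr)
      = maa⁻¹ *ᵥ ((Mblk muu mau maa qu *ᵥ v) ∘ Sum.inr) := by
  have hdet : IsUnit maa.det := (Matrix.isUnit_iff_isUnit_det _).1 (posDef_maa hM).isUnit
  rw [Mblk_mulVec_comp_inr, mulVec_add, mulVec_mulVec (v ∘ Sum.inr), nonsing_inv_mul _ hdet,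
    one_mulVec, yA]

/-- The actuated part of the kinetic energy is at most the total kinetic energy. -/
theorem dotProduct_inv_mulVec_momentum_le {qu : Fin s → ℝ}
    (hM : (Mblk muu mau maa qu).PosDef) (v : (Fin s ⊕ Fin m) → ℝ) :
    ((Mblk muu mau maa qu *ᵥ v) ∘ Sum.inr)
        ⬝ᵥ maa⁻¹ *ᵥ ((Mblk muu mau maa qu *ᵥ v) ∘ Sum.inr)
      ≤ v ⬝ᵥ Mblk muu mau maa qu *ᵥ v := by
  have hdet : IsUnit maa.det := (Matrix.isUnit_iff_isUnit_det _).1 (posDef_maa hM).isUnit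
  set p := (Mblk muu mau maa qu *ᵥ v) ∘ Sum.inr with hp
  set w : (Fin s ⊕ Fin m) → ℝ := Sum.elim 0 (maa⁻¹ *ᵥ p) with hw
  have h := hM.posSemidef.dotProduct_mulVec_nonneg (v - w)
  have hwv : w ⬝ᵥ Mblk muu mau maa qu *ᵥ v = p ⬝ᵥ maa⁻¹ *ᵥ p := by
    rw [dotProduct_comm, hw, dotProduct_sum_elim]
    simp [hp]
  have hvw : v ⬝ᵥ Mblk muu mau maa qu *ᵥ w = w ⬝ᵥ Mblk muu mau maa qu *ᵥ v :=
    hM.1.dotProduct_mulVec_comm v w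
  have hww : w ⬝ᵥ Mblk muu mau maa qu *ᵥ w = p ⬝ᵥ maa⁻¹ *ᵥ p := by
    have : (Mblk muu mau maa qu *ᵥ w) ∘ Sum.inr = p := by
      rw [Mblk_mulVec_comp_inr]
      simp [hw, mulVec_mulVec, mul_nonsing_inv _ hdet]
    rw [dotProduct_comm]
    conv_lhs => rw [hw, dotProduct_sum_elim, ← hw, this]
    simp
  simp only [star_trivial, mulVec_sub, dotProduct_sub, sub_dotProduct] at h
  linarith

theorem hasDerivWithinAt_potential {V : (Fin s → ℝ) → ℝ} (hV : Differentiable ℝ V)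
    {q : ℝ → (Fin s ⊕ Fin m) → ℝ} {v : (Fin s ⊕ Fin m) → ℝ} {S : Set ℝ} {t : ℝ}
    (hq : HasDerivWithinAt q v S t) :
    HasDerivWithinAt (fun t => V (q t ∘ Sum.inl))
      ((v ∘ Sum.inl) ⬝ᵥ grad V (q t ∘ Sum.inl)) S t := by
  have hqu : HasDerivWithinAt (fun t => q t ∘ Sum.inl) (v ∘ Sum.inl) S t :=
    hasDerivWithinAt_pi.2 fun i => hasDerivWithinAt_pi.1 hq _
  have h := (hV (q t ∘ Sum.inl)).hasFDerivAt.comp_hasDerivWithinAt t hqu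
  rw [ContinuousLinearMap.apply_eq_sum_single] at h
  rw [dotProduct_comm]
  exact h

end Mechanics

/-- Corollary 1: with `k_e, k_a, k_u` of the same sign, the closed loop
of the mechanical system (inner loop `u = τ − ∇V_a(q_a)`) with the PID and external
disturbance `d` is `L₂`-stable from `d` to `y_d` with gain `1/λ_min(K_P)`. -/
theorem corollary1_L2_stability
    {s m : ℕ} (hs : 1 ≤ s) (hm : 1 ≤ m)
    (muu : (Fin s → ℝ) → Matrix (Fin s) (Fin s) ℝ)
    (mau : (Fin s → ℝ) → Matrix (Fin m) (Fin s) ℝ)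
    (maa : Matrix (Fin m) (Fin m) ℝ)
    (hmuu : ∀ i j, ContDiff ℝ (⊤ : ℕ∞) fun x => muu x i j)
    (hmau : ∀ i j, ContDiff ℝ (⊤ : ℕ∞) fun x => mau x i j)
    (hmaa : maa.IsSymm)
    (hM : ∀ qu, (Mblk muu mau maa qu).PosDef)
    (Vu : (Fin s → ℝ) → ℝ) (Va : (Fin m → ℝ) → ℝ)
    (hVu : ContDiff ℝ (⊤ : ℕ∞) Vu) (hVa : ContDiff ℝ (⊤ : ℕ∞) Va)
    (hVubdd : ∃ c : ℝ, ∀ x, c ≤ Vu x)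
    (ke ka ku : ℝ) (hke : ke ≠ 0) (hka : ka ≠ 0) (hku : ku ≠ 0) (hkaku : ka ≠ ku)
    (hsign : (0 < ke ∧ 0 < ka ∧ 0 < ku) ∨ (ke < 0 ∧ ka < 0 ∧ ku < 0))
    (KP KI KD : Matrix (Fin m) (Fin m) ℝ)
    (hKP : KP.PosDef) (hKI : KI.PosDef) (hKD : KD.PosSemidef)
    (q qd qdd : ℝ → (Fin s ⊕ Fin m) → ℝ)
    (τ : ℝ → Fin m → ℝ) (hτ : ContinuousOn τ (Ici 0))
    (hq : ∀ t ∈ Ici (0:ℝ), HasDerivWithinAt q (qd t) (Ici 0) t)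
    (hqd : ∀ t ∈ Ici (0:ℝ), HasDerivWithinAt qd (qdd t) (Ici 0) t)
    (hqdd : ContinuousOn qdd (Ici 0))
    (hEL : ∀ t ∈ Ici (0:ℝ),
      Mblk muu mau maa (q t ∘ Sum.inl) *ᵥ qdd t
        + Cvec muu mau maa (q t) (qd t)
        + Sum.elim (grad Vu (q t ∘ Sum.inl)) (grad Va (q t ∘ Sum.inr))
      = Sum.elim (0 : Fin s → ℝ) (τ t))
    (d : ℝ → Fin m → ℝ) (hd : ContinuousOn d (Ici 0))
    (z₁ ydd : ℝ → Fin m → ℝ)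
    (hz₁ : ∀ t ∈ Ici (0:ℝ), HasDerivWithinAt z₁ (ydSig mau maa ka ku q qd t) (Ici 0) t)
    (hydd : ∀ t ∈ Ici (0:ℝ), HasDerivWithinAt (ydSig mau maa ka ku q qd) (ydd t) (Ici 0) t)
    (hPID : ∀ t ∈ Ici (0:ℝ),
      ke • (τ t - grad Va (q t ∘ Sum.inr))
        = d t - (KP *ᵥ ydSig mau maa ka ku q qd t + KI *ᵥ z₁ t + KD *ᵥ ydd t)) :
    ∃ β₃ : ℝ, 0 ≤ β₃ ∧ ∀ t ∈ Ici (0:ℝ),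
      Real.sqrt (∫ σ in (0:ℝ)..t,
          ydSig mau maa ka ku q qd σ ⬝ᵥ ydSig mau maa ka ku q qd σ)
        ≤ (1 / (⨅ i, hKP.1.eigenvalues i)) * Real.sqrt (∫ σ in (0:ℝ)..t, d σ ⬝ᵥ d σ)
          + β₃ := by
  obtain ⟨c, hc⟩ := hVubdd
  have : Nonempty (Fin m) := ⟨⟨0, hm⟩⟩
  have hl := hKP.iInf_eigenvalues_pos
  have hinv : (maa⁻¹).PosDef := (posDef_maa (hM 0)).inv
  set y := ydSig mau maa ka ku q qd with hy
  set P := fun t => Mblk muu mau maa (q t ∘ Sum.inl) *ᵥ qd t with hP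
  set u := fun t => τ t - grad Va (q t ∘ Sum.inr) with hu
  set Ea := fun t => (1 / 2 : ℝ) * ((P t ∘ Sum.inr) ⬝ᵥ maa⁻¹ *ᵥ (P t ∘ Sum.inr)) with hEa
  set E := fun t => (1 / 2 : ℝ) * (qd t ⬝ᵥ P t) with hE
  have hPd : ∀ t ∈ Ici (0 : ℝ), HasDerivWithinAt P _ (Ici 0) t := fun t ht =>
    hasDerivWithinAt_momentum (maa := maa) hmuu hmau (hq t ht) (hqd t ht)
  have hpd : ∀ t ∈ Ici (0 : ℝ), HasDerivWithinAt (fun t => P t ∘ Sum.inr) (u t) (Ici 0) t := by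
    intro t ht
    refine hasDerivWithinAt_pi.2 fun i => ?_
    refine (hasDerivWithinAt_pi.1 (hPd t ht) (Sum.inr i)).congr_deriv ?_
    have h := congrFun (hEL t ht) (Sum.inr i)
    simp only [Pi.add_apply, Sum.elim_inr, Cvec_apply_inr] at h
    simp only [hu, Pi.add_apply, Pi.sub_apply]
    linarith
  have hEad : ∀ t ∈ Ici (0 : ℝ), HasDerivWithinAt Ea
      ((P t ∘ Sum.inr) ⬝ᵥ maa⁻¹ *ᵥ u t) (Ici 0) t := fun t ht =>
    hasDerivWithinAt_half_quadratic hinv.1 (hpd t ht)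
  have hEd : ∀ t ∈ Ici (0 : ℝ), HasDerivWithinAt (fun t => E t + Vu (q t ∘ Sum.inl))
      ((qd t ∘ Sum.inr) ⬝ᵥ u t) (Ici 0) t := by
    intro t ht
    refine (((hasDerivWithinAt_dotProduct (hqd t ht) (hPd t ht)).const_mul (1 / 2 : ℝ)).add
      (hasDerivWithinAt_potential (hVu.differentiable (by simp)) (hq t ht))).congr_deriv ?_
    have h := congrArg (fun x => qd t ⬝ᵥ x) (hEL t ht)
    simp only [dotProduct_add, dotProduct_sum_elim, dotProduct_Cvec, dotProduct_zero] at h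
    have hsymm : qdd t ⬝ᵥ P t = qd t ⬝ᵥ Mblk muu mau maa (q t ∘ Sum.inl) *ᵥ qdd t :=
      (hM (q t ∘ Sum.inl)).1.dotProduct_mulVec_comm _ _
    simp only [hu, dotProduct_sub, dotProduct_add, hsymm]
    linarith
  have hyeq : ∀ t, y t = ka • (maa⁻¹ *ᵥ (P t ∘ Sum.inr))
      + ku • (qd t ∘ Sum.inr - maa⁻¹ *ᵥ (P t ∘ Sum.inr)) := by
    intro t
    have hA := yA_eq_inv_mulVec_momentum (hM (q t ∘ Sum.inl)) (qd t)
    have hU : yU mau maa (q t ∘ Sum.inl) (qd t ∘ Sum.inl)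
        = qd t ∘ Sum.inr - maa⁻¹ *ᵥ (P t ∘ Sum.inr) := by
      rw [← hA, yU, yA]; abel
    rw [hy, ydSig, hU, hA]
  refine exists_L2_gain_of_storage hl (y := y) (d := d)
    (fun t ht => (hydd t ht).continuousWithinAt) hd
    (S := fun t => ke * ka * Ea t + ke * ku * (E t + Vu (q t ∘ Sum.inl) - Ea t - c)
      + (1 / 2 : ℝ) * (y t ⬝ᵥ KD *ᵥ y t) + (1 / 2 : ℝ) * (z₁ t ⬝ᵥ KI *ᵥ z₁ t))
    (fun t ht => ((((hEad t ht).const_mul (ke * ka)).add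
      ((((hEd t ht).sub (hEad t ht)).sub_const c).const_mul (ke * ku))).add
      (hasDerivWithinAt_half_quadratic hKD.1 (hydd t ht))).add
      (hasDerivWithinAt_half_quadratic hKI.1 (hz₁ t ht))) ?_ ?_
  · intro t ht
    have hkeka : 0 ≤ ke * ka := by rcases hsign with h | h <;> nlinarith
    have hkeku : 0 ≤ ke * ku := by rcases hsign with h | h <;> nlinarith
    have h1 : 0 ≤ Ea t := by
      have := hinv.posSemidef.dotProduct_mulVec_nonneg (P t ∘ Sum.inr)
      simp only [star_trivial] at this
      simp only [hEa]; linarith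
    have h2 : 0 ≤ E t + Vu (q t ∘ Sum.inl) - Ea t - c := by
      have := dotProduct_inv_mulVec_momentum_le (hM (q t ∘ Sum.inl)) (qd t)
      have := hc (q t ∘ Sum.inl)
      simp only [hEa, hE, hP]; linarith
    have h3 := hKD.dotProduct_mulVec_nonneg (y t)
    have h4 := hKI.posSemidef.dotProduct_mulVec_nonneg (z₁ t)
    simp only [star_trivial] at h3 h4
    have := mul_nonneg hkeka h1
    have := mul_nonneg hkeku h2
    linarith
  · intro t ht
    have h1 := hKP.1.iInf_eigenvalues_mul_le (y t)
    have h2 := congrArg (fun x => y t ⬝ᵥ x) (hPID t ht)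
    simp only [dotProduct_sub, dotProduct_add, dotProduct_smul, smul_eq_mul] at h2
    have hsymma : (P t ∘ Sum.inr) ⬝ᵥ maa⁻¹ *ᵥ u t = (maa⁻¹ *ᵥ (P t ∘ Sum.inr)) ⬝ᵥ u t := by
      rw [hinv.1.dotProduct_mulVec_comm, dotProduct_comm]
    have h3 : y t ⬝ᵥ u t = ka * ((maa⁻¹ *ᵥ (P t ∘ Sum.inr)) ⬝ᵥ u t)
        + ku * ((qd t ∘ Sum.inr) ⬝ᵥ u t - (maa⁻¹ *ᵥ (P t ∘ Sum.inr)) ⬝ᵥ u t) := by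
      rw [hyeq]
      simp [add_dotProduct, sub_dotProduct]
    have h4 : ke * (y t ⬝ᵥ u t) = ke * (y t ⬝ᵥ τ t - y t ⬝ᵥ grad Va (q t ∘ Sum.inr)) := by
      simp only [hu, dotProduct_sub]
    rw [h3] at h4
    rw [hKI.1.dotProduct_mulVec_comm (z₁ t), hsymma]
    linarith
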